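/- arXiv:1212.6145 — 6 statements merged into one kernel-verified Lean document; each statement's English description precedes it below -/
import Mathlib

section
/- For every θ₀ with 0 < θ₀ < π/2 there exists ν > 0 with the following property. Let R be a real 2×2 matrix with det R = 1 such that: (i) |(R·e₁)₂| < tan(ν)·|(R·e₁)₁|, where e₁ = (1,0); (ii) ‖R·e₁‖ ≥ 3; (iii) there exists a nonzero f ∈ ℝ² with |f₁| < tan(θ₀)·|f₂| and |(R·f)₁| < tan(θ₀)·|(R·f)₂|. Then |trace R| > 2 — in particular R has two distinct real eigenvalues λ and λ⁻¹ — and trace R (hence each eigenvalue of R) has the same sign as the entry (R·e₁)₁ = R₁₁. -/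
open Real

/-- If `f = (x, y)` and its image `(a x + b y, c x + d y)` both lie in the cone of slope `T` about
the second axis while the first column `(a, c)` is long and close to the first axis, then the
entry `a` dominates `d`. -/
lemma abs_lower_right_lt_of_cone {a b c d x y T t : ℝ} (hT : 0 < T) (ht : 0 < t)
    (ht' : t ≤ 1 / 10) (hTt : T * t ≤ 1 / 20) (hdet : a * d - b * c = 1) (hc : |c| < t * |a|)
    (hlen : 9 ≤ a ^ 2 + c ^ 2) (hx : |x| < T * |y|)
    (hw : |a * x + b * y| < T * |c * x + d * y|) : |d| < |a| - 2 := by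
  have hy : 0 < |y| := by
    by_contra! h
    nlinarith [abs_nonneg x]
  have hc' : |c| ≤ 1 / 10 * |a| := by nlinarith [abs_nonneg a]
  have ha : 29 / 10 ≤ |a| := by
    by_contra! h
    nlinarith [sq_abs a, sq_abs c, abs_nonneg a, abs_nonneg c]
  set w := a * x + b * y with hwdef
  have hz : a * (c * x + d * y) = y + c * w := by
    rw [hwdef]; linear_combination y * hdet
  have hd : a * d * y = y + c * w - c * a * x := by
    rw [hwdef]; linear_combination y * hdet
  have hcw : |c * w| ≤ t * (|a| * |w|) := by
    rw [abs_mul, ← mul_assoc]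
    exact mul_le_mul_of_nonneg_right hc.le (abs_nonneg w)
  have hzabs : |a| * |c * x + d * y| ≤ |y| + t * (|a| * |w|) := by
    rw [← abs_mul, hz]
    exact (abs_add_le _ _).trans (by linarith)
  have haw : |a| * |w| ≤ T * (|y| + t * (|a| * |w|)) := by
    calc |a| * |w| ≤ |a| * (T * |c * x + d * y|) := by gcongr
      _ = T * (|a| * |c * x + d * y|) := by ring
      _ ≤ _ := by gcongr
  have hP : 0 ≤ |a| * |w| := by positivity
  have haw' : 19 / 20 * (|a| * |w|) ≤ T * |y| := by
    nlinarith [mul_le_mul_of_nonneg_right hTt hP]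
  have htaw : t * (|a| * |w|) ≤ 1 / 19 * |y| := by
    nlinarith [mul_le_mul_of_nonneg_left haw' ht.le, mul_le_mul_of_nonneg_right hTt hy.le]
  have hcax : |c * a * x| ≤ 1 / 20 * |a| ^ 2 * |y| := by
    rw [abs_mul, abs_mul]
    calc |c| * |a| * |x| ≤ t * |a| * |a| * (T * |y|) := by gcongr
      _ = T * t * (|a| ^ 2 * |y|) := by ring
      _ ≤ 1 / 20 * (|a| ^ 2 * |y|) := by gcongr
      _ = _ := by ring
  have hady : |a| * |d| * |y| ≤ (1 + 1 / 19 + 1 / 20 * |a| ^ 2) * |y| := by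
    rw [← abs_mul, ← abs_mul, hd]
    have h₁ := abs_sub (y + c * w) (c * a * x)
    have h₂ := abs_add_le y (c * w)
    linarith
  have had := le_of_mul_le_mul_right hady hy
  by_contra! h
  nlinarith [mul_le_mul_of_nonneg_left h (abs_nonneg a)]

/-- A root of the characteristic equation of a 2×2 matrix of determinant one is an eigenvalue. -/
lemma hasEigenvalue_toLin'_of_det_eq_one {R : Matrix (Fin 2) (Fin 2) ℝ} (hR : R.det = 1) {μ : ℝ}
    (hμ : μ ^ 2 - R.trace * μ + 1 = 0) : Module.End.HasEigenvalue (Matrix.toLin' R) μ := by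
  rw [Module.End.hasEigenvalue_iff_isRoot_charpoly, Matrix.charpoly_toLin', Matrix.charpoly_fin_two]
  simpa [Polynomial.IsRoot, hR] using hμ

/-- A real 2×2 matrix of determinant one with `2 < |trace|` has two distinct real eigenvalues,
inverse to each other and of the sign of the trace. -/
lemma exists_hasEigenvalue_of_two_lt_abs_trace {R : Matrix (Fin 2) (Fin 2) ℝ} (hR : R.det = 1)
    (htr : 2 < |R.trace|) :
    ∃ lam : ℝ, lam ≠ lam⁻¹ ∧ Module.End.HasEigenvalue (Matrix.toLin' R) lam ∧
      Module.End.HasEigenvalue (Matrix.toLin' R) lam⁻¹ ∧ (0 < lam ↔ 0 < R.trace) := by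
  set τ := R.trace with hτ
  have hdisc : 0 < τ ^ 2 - 4 := by nlinarith [sq_abs τ]
  have hs := Real.sqrt_pos.mpr hdisc
  have hsq := Real.sq_sqrt hdisc.le
  set s := √(τ ^ 2 - 4)
  have hmul : (τ + s) / 2 * ((τ - s) / 2) = 1 := by linear_combination -hsq / 4
  have hinv : ((τ + s) / 2)⁻¹ = (τ - s) / 2 := inv_eq_of_mul_eq_one_right hmul
  refine ⟨(τ + s) / 2, ?_, ?_, ?_, ?_⟩
  · rw [hinv]
    intro h
    linarith
  · exact hasEigenvalue_toLin'_of_det_eq_one hR (by rw [← hτ]; linear_combination hsq / 4)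
  · rw [hinv]
    exact hasEigenvalue_toLin'_of_det_eq_one hR (by rw [← hτ]; linear_combination hsq / 4)
  · constructor
    · intro h
      have : 0 < (τ - s) / 2 := by rw [← hinv]; exact inv_pos.mpr h
      linarith
    · intro h
      positivity

/-- Hyperbolicity criterion for a symplectic 2×2 matrix (Lemma 7.2 of the paper):
if `R·e₁` lies in a thin cone about the horizontal axis and is long, and some vector of the
cone of angle `θ₀` about the vertical axis is mapped into that same cone, then `R` is
`ℝ`-diagonalizable with eigenvalues `λ, λ⁻¹` of the sign of `(R·e₁)₁ = R₁₁`. -/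
theorem symplectic_cone_hyperbolic (θ₀ : ℝ) (hθ₀ : 0 < θ₀) (hθ₀' : θ₀ < Real.pi / 2) :
    ∃ ν > 0, ∀ R : Matrix (Fin 2) (Fin 2) ℝ, R.det = 1 →
      |R 1 0| < Real.tan ν * |R 0 0| →
      3 ≤ Real.sqrt ((R 0 0) ^ 2 + (R 1 0) ^ 2) →
      (∃ f : Fin 2 → ℝ, f ≠ 0 ∧ |f 0| < Real.tan θ₀ * |f 1| ∧
        |(R.mulVec f) 0| < Real.tan θ₀ * |(R.mulVec f) 1|) →
      2 < |R.trace| ∧ (0 < R.trace ↔ 0 < R 0 0) ∧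
      ∃ lam : ℝ, lam ≠ lam⁻¹ ∧
        Module.End.HasEigenvalue (Matrix.toLin' R) lam ∧
        Module.End.HasEigenvalue (Matrix.toLin' R) lam⁻¹ ∧
        (0 < lam ↔ 0 < R 0 0) := by
  have hT : 0 < Real.tan θ₀ := Real.tan_pos_of_pos_of_lt_pi_div_two hθ₀ hθ₀'
  set T := Real.tan θ₀
  have ht : 0 < min (1 / 10) (1 / (20 * T)) := by positivity
  have hTt : T * min (1 / 10) (1 / (20 * T)) ≤ 1 / 20 := by
    calc T * min (1 / 10) (1 / (20 * T)) ≤ T * (1 / (20 * T)) := by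
          gcongr
          exact min_le_right _ _
      _ = 1 / 20 := by field_simp
  refine ⟨Real.arctan (min (1 / 10) (1 / (20 * T))), Real.arctan_pos.mpr ht, ?_⟩
  rintro R hR hc hlen ⟨f, -, hf, hRf⟩
  rw [Real.tan_arctan] at hc
  simp only [Matrix.mulVec, dotProduct, Fin.sum_univ_two] at hRf
  have hlen' : 9 ≤ R 0 0 ^ 2 + R 1 0 ^ 2 := by
    have := (Real.le_sqrt' (by norm_num)).mp hlen
    linarith
  have hd := abs_lower_right_lt_of_cone hT ht (min_le_left _ _) hTt
    (by rw [← hR, Matrix.det_fin_two]) hc hlen' hf hRf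
  have htr : R.trace = R 0 0 + R 1 1 := Matrix.trace_fin_two R
  have hd₁ := neg_abs_le (R 1 1)
  have hd₂ := le_abs_self (R 1 1)
  have key : 2 < |R.trace| ∧ (0 < R.trace ↔ 0 < R 0 0) := by
    rw [htr]
    rcases le_or_gt (R 0 0) 0 with ha | ha
    · rw [abs_of_nonpos ha] at hd
      exact ⟨lt_abs.mpr (Or.inr (by linarith)), fun h => by linarith, fun h => by linarith⟩
    · rw [abs_of_pos ha] at hd
      exact ⟨lt_abs.mpr (Or.inl (by linarith)), fun _ => ha, fun _ => by linarith⟩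
  obtain ⟨lam, hne, h₁, h₂, hsign⟩ := exists_hasEigenvalue_of_two_lt_abs_trace hR key.1
  exact ⟨key.1, key.2, lam, hne, h₁, h₂, hsign.trans key.2⟩
end

section
/- Let R : [0,2] → M₂(ℝ) be a continuous path of real 2×2 matrices with det R(t) = 1 for all t, R(0) = I, and det(R(t) − I) ≠ 0 for all t ∈ [1,2]. Let θ : [0,2] → ℝ be continuous with θ(0) = 0 such that for every t there is a symmetric positive-definite matrix S(t) with R(t) = S(t)·Rot(θ(t)). Let α : [0,2] → ℝ be continuous with α(0) = 0 such that for every t there is r(t) > 0 with R(t)·(1,0) = r(t)·(cos α(t), sin α(t)). Fix k ∈ ℤ. (a) If R(2) = −I and α(1) ∈ [2kπ + π/2, 2kπ + 3π/2], then θ(2) = (2k+1)π. (b) If R(2) = diag(2, 1/2) and α(1) ∈ [2kπ − π/2, 2kπ + π/2], then θ(2) = 2kπ. -/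
open Real Set

noncomputable section

/-- The rotation matrix of angle `φ`. -/
def Rot (φ : ℝ) : Matrix (Fin 2) (Fin 2) ℝ :=
  !![Real.cos φ, -Real.sin φ; Real.sin φ, Real.cos φ]

theorem IsPreconnected.lt_of_forall_ne {s : Set ℝ} (hs : IsPreconnected s) {f : ℝ → ℝ}
    (hf : ContinuousOn f s) {a c : ℝ} (ha : a ∈ s) (hac : f a < c) (hne : ∀ t ∈ s, f t ≠ c)
    {t : ℝ} (ht : t ∈ s) : f t < c := by
  by_contra! h
  obtain ⟨x, hx, hxc⟩ := hs.intermediate_value ha ht hf ⟨hac.le, h⟩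
  exact hne x hx hxc

theorem IsPreconnected.gt_of_forall_ne {s : Set ℝ} (hs : IsPreconnected s) {f : ℝ → ℝ}
    (hf : ContinuousOn f s) {a c : ℝ} (ha : a ∈ s) (hac : c < f a) (hne : ∀ t ∈ s, f t ≠ c)
    {t : ℝ} (ht : t ∈ s) : c < f t := by
  by_contra! h
  obtain ⟨x, hx, hxc⟩ := hs.intermediate_value ht ha hf ⟨h, hac.le⟩
  exact hne x hx hxc

theorem polar_trace_and_angle {A S : Matrix (Fin 2) (Fin 2) ℝ} {φ : ℝ} (hA : A.det = 1)
    (hS : S.PosDef) (h : A = S * Rot φ) :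
    (∃ τ : ℝ, 2 ≤ τ ∧ A 0 0 + A 1 1 = τ * Real.cos φ ∧ A 1 0 - A 0 1 = τ * Real.sin φ) ∧
      0 < A 0 0 * Real.cos φ + A 1 0 * Real.sin φ := by
  have hcs := Real.sin_sq_add_cos_sq φ
  have hsymm : S 1 0 = S 0 1 := by simpa using hS.isHermitian.apply 0 1
  have hSdet : S 0 0 * S 1 1 - S 0 1 * S 0 1 = 1 := by
    have hrot : (Rot φ).det = 1 := by
      rw [Rot, Matrix.det_fin_two_of]
      linarith
    rw [h, Matrix.det_mul, hrot, mul_one, Matrix.det_fin_two, hsymm] at hA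
    exact hA
  have h0 : 0 < S 0 0 := hS.diag_pos
  have h1 : 0 < S 1 1 := hS.diag_pos
  have e00 : A 0 0 = S 0 0 * Real.cos φ + S 0 1 * Real.sin φ := by
    simp [h, Rot, Matrix.mul_apply, Fin.sum_univ_two]
  have e01 : A 0 1 = -(S 0 0 * Real.sin φ) + S 0 1 * Real.cos φ := by
    simp [h, Rot, Matrix.mul_apply, Fin.sum_univ_two]
  have e10 : A 1 0 = S 0 1 * Real.cos φ + S 1 1 * Real.sin φ := by
    simp [h, Rot, Matrix.mul_apply, Fin.sum_univ_two, hsymm]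
  have e11 : A 1 1 = -(S 0 1 * Real.sin φ) + S 1 1 * Real.cos φ := by
    simp [h, Rot, Matrix.mul_apply, Fin.sum_univ_two, hsymm]
  refine ⟨⟨S 0 0 + S 1 1, ?_, ?_, ?_⟩, ?_⟩
  · nlinarith [sq_nonneg (S 0 0 - S 1 1), sq_nonneg (S 0 1)]
  · rw [e00, e11]; ring
  · rw [e10, e01]; ring
  · rw [e00, e10]
    have key : S 0 0 * ((S 0 0 * Real.cos φ + S 0 1 * Real.sin φ) * Real.cos φ +
        (S 0 1 * Real.cos φ + S 1 1 * Real.sin φ) * Real.sin φ) =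
        (S 0 0 * Real.cos φ + S 0 1 * Real.sin φ) ^ 2 + Real.sin φ ^ 2 := by
      linear_combination Real.sin φ ^ 2 * hSdet
    have hpos : 0 < (S 0 0 * Real.cos φ + S 0 1 * Real.sin φ) ^ 2 + Real.sin φ ^ 2 := by
      rcases eq_or_ne (Real.sin φ) 0 with hs | hs
      · have hc : Real.cos φ ≠ 0 := by
          intro hc
          simp [hs, hc] at hcs
        rw [hs, mul_zero, add_zero]
        have := mul_ne_zero h0.ne' hc
        positivity
      · positivity
    rw [← key] at hpos
    exact pos_of_mul_pos_right hpos h0.le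

theorem det_sub_one_fin_two {A : Matrix (Fin 2) (Fin 2) ℝ} (hA : A.det = 1) :
    (A - 1).det = 2 - (A 0 0 + A 1 1) := by
  rw [Matrix.det_fin_two] at hA ⊢
  simp
  linarith

/-- Computation of the Conley–Zehnder index of a path of symplectic matrices via the
rotation angle of the polar decomposition and the angle swept by the image of `e₁`
(Lemma 7.1 of the paper). -/
theorem conley_zehnder_angle
    (R : ℝ → Matrix (Fin 2) (Fin 2) ℝ) (θ α : ℝ → ℝ) (k : ℤ)
    (hRcont : ContinuousOn R (Icc 0 2))
    (hdet : ∀ t ∈ Icc (0:ℝ) 2, (R t).det = 1)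
    (hR0 : R 0 = 1)
    (hnd : ∀ t ∈ Icc (1:ℝ) 2, (R t - 1).det ≠ 0)
    (hθcont : ContinuousOn θ (Icc 0 2)) (hθ0 : θ 0 = 0)
    (hpolar : ∀ t ∈ Icc (0:ℝ) 2, ∃ S : Matrix (Fin 2) (Fin 2) ℝ,
      S.PosDef ∧ R t = S * Rot (θ t))
    (hαcont : ContinuousOn α (Icc 0 2)) (hα0 : α 0 = 0)
    (hα : ∀ t ∈ Icc (0:ℝ) 2, ∃ r : ℝ, 0 < r ∧
      (R t).mulVec ![1, 0] = r • ![Real.cos (α t), Real.sin (α t)]) :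
    ((R 2 = -1 ∧
        α 1 ∈ Icc (2 * (k : ℝ) * π + π / 2) (2 * (k : ℝ) * π + 3 * π / 2)) →
      θ 2 = (2 * (k : ℝ) + 1) * π) ∧
    ((R 2 = Matrix.diagonal ![2, 1/2] ∧
        α 1 ∈ Icc (2 * (k : ℝ) * π - π / 2) (2 * (k : ℝ) * π + π / 2)) →
      θ 2 = 2 * (k : ℝ) * π) := by
  have hπ := Real.pi_pos
  have htr : ∀ t ∈ Icc (0:ℝ) 2, (∃ τ : ℝ, 2 ≤ τ ∧ R t 0 0 + R t 1 1 = τ * Real.cos (θ t) ∧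
      R t 1 0 - R t 0 1 = τ * Real.sin (θ t)) ∧
      0 < R t 0 0 * Real.cos (θ t) + R t 1 0 * Real.sin (θ t) := by
    intro t ht
    obtain ⟨S, hS, h⟩ := hpolar t ht
    exact polar_trace_and_angle (hdet t ht) hS h
  have hcos : ∀ t ∈ Icc (0:ℝ) 2, 0 < Real.cos (α t - θ t) := by
    intro t ht
    obtain ⟨r, hr, h⟩ := hα t ht
    have h0 : R t 0 0 = r * Real.cos (α t) := by
      simpa [Matrix.mulVec, dotProduct, Fin.sum_univ_two] using congrFun h 0
    have h1 : R t 1 0 = r * Real.sin (α t) := by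
      simpa [Matrix.mulVec, dotProduct, Fin.sum_univ_two] using congrFun h 1
    have hpos := (htr t ht).2
    rw [h0, h1] at hpos
    rw [Real.cos_sub]
    refine pos_of_mul_pos_right (a := r) ?_ hr.le
    linarith
  have h02 : (0:ℝ) ∈ Icc (0:ℝ) 2 := by norm_num
  have h1 : (1:ℝ) ∈ Icc (0:ℝ) 2 := by norm_num
  have h2 : (2:ℝ) ∈ Icc (0:ℝ) 2 := by norm_num
  have h1' : (1:ℝ) ∈ Icc (1:ℝ) 2 := by norm_num
  have h2' : (2:ℝ) ∈ Icc (1:ℝ) 2 := by norm_num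
  have hsub : Icc (1:ℝ) 2 ⊆ Icc 0 2 := Icc_subset_Icc_left zero_le_one
  have hlt : α 1 - θ 1 < π / 2 := by
    refine isPreconnected_Icc.lt_of_forall_ne (hαcont.sub hθcont) h02 ?_ ?_ h1
    · simp only [Pi.sub_apply, hα0, hθ0]; linarith
    · intro t ht h
      have := hcos t ht
      simp only [Pi.sub_apply] at h
      rw [h, Real.cos_pi_div_two] at this
      exact this.false
  have hgt : -(π / 2) < α 1 - θ 1 := by
    refine isPreconnected_Icc.gt_of_forall_ne (hαcont.sub hθcont) h02 ?_ ?_ h1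
    · simp only [Pi.sub_apply, hα0, hθ0]; linarith
    · intro t ht h
      have := hcos t ht
      simp only [Pi.sub_apply] at h
      rw [h, Real.cos_neg, Real.cos_pi_div_two] at this
      exact this.false
  have hθ' := hθcont.mono hsub
  have htrcont : ContinuousOn (fun t => R t 0 0 + R t 1 1) (Icc 1 2) := by
    have hR := hRcont.mono hsub
    have he (i j : Fin 2) : ContinuousOn (fun t => R t i j) (Icc 1 2) :=
      continuousOn_pi.mp (continuousOn_pi.mp hR i) j
    exact (he 0 0).add (he 1 1)
  have htrne : ∀ t ∈ Icc (1:ℝ) 2, R t 0 0 + R t 1 1 ≠ 2 := by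
    intro t ht h
    exact hnd t ht (by rw [det_sub_one_fin_two (hdet t (hsub ht)), h, sub_self])
  have hsin : R 2 1 0 = R 2 0 1 → Real.sin (θ 2) = 0 := by
    intro h
    obtain ⟨⟨τ, hτ, -, hs⟩, -⟩ := htr 2 h2
    rw [h, sub_self] at hs
    rcases mul_eq_zero.mp hs.symm with h | h
    · linarith
    · exact h
  constructor
  · rintro ⟨hR2, hα1, hα1'⟩
    have hne : ∀ t ∈ Icc (1:ℝ) 2, ∀ n : ℤ, θ t ≠ n * (2 * π) := by
      intro t ht n h
      have hlt2 : R t 0 0 + R t 1 1 < 2 :=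
        isPreconnected_Icc.lt_of_forall_ne htrcont h2' (by simp [hR2]; norm_num) htrne ht
      obtain ⟨⟨τ, hτ, hc, -⟩, -⟩ := htr t (hsub ht)
      rw [h, Real.cos_int_mul_two_pi] at hc
      linarith
    have hl : (k : ℝ) * (2 * π) < θ 2 :=
      isPreconnected_Icc.gt_of_forall_ne hθ' h1' (by linarith) (fun t ht => hne t ht k) h2'
    have hu : θ 2 < ((k + 1 : ℤ) : ℝ) * (2 * π) :=
      isPreconnected_Icc.lt_of_forall_ne hθ' h1' (by push_cast; linarith)
        (fun t ht => hne t ht (k + 1)) h2'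
    push_cast at hu
    have hs : Real.sin (θ 2) = 0 := hsin (by simp [hR2])
    have hs' : Real.sin (θ 2 - (2 * (k : ℝ) + 1) * π) = 0 := by
      rw [show θ 2 - (2 * (k : ℝ) + 1) * π = θ 2 - π - k * (2 * π) by ring,
        Real.sin_sub_int_mul_two_pi, Real.sin_sub_pi, hs, neg_zero]
    have := (Real.sin_eq_zero_iff_of_lt_of_lt (by linarith) (by linarith)).mp hs'
    linarith
  · rintro ⟨hR2, hα1, hα1'⟩
    have hcospos : ∀ t ∈ Icc (1:ℝ) 2, 0 < Real.cos (θ t) := by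
      intro t ht
      have hgt2 : 2 < R t 0 0 + R t 1 1 :=
        isPreconnected_Icc.gt_of_forall_ne htrcont h2' (by simp [hR2]) htrne ht
      obtain ⟨⟨τ, hτ, hc, -⟩, -⟩ := htr t (hsub ht)
      refine pos_of_mul_pos_right (a := τ) ?_ (by linarith)
      linarith
    have hl : (k : ℝ) * (2 * π) - π < θ 2 := by
      refine isPreconnected_Icc.gt_of_forall_ne hθ' h1' (by linarith) (fun t ht h => ?_) h2'
      have := hcospos t ht
      rw [h, Real.cos_sub_pi, Real.cos_int_mul_two_pi] at this
      linarith
    have hu : θ 2 < (k : ℝ) * (2 * π) + π := by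
      refine isPreconnected_Icc.lt_of_forall_ne hθ' h1' (by linarith) (fun t ht h => ?_) h2'
      have := hcospos t ht
      rw [h, Real.cos_add_pi, Real.cos_int_mul_two_pi] at this
      linarith
    have hs : Real.sin (θ 2) = 0 := hsin (by simp [hR2])
    have hs' : Real.sin (θ 2 - k * (2 * π)) = 0 := by
      rw [Real.sin_sub_int_mul_two_pi, hs]
    have := (Real.sin_eq_zero_iff_of_lt_of_lt (by linarith) (by linarith)).mp hs'
    linarith
end
end

section
/- Let k, l, m : ℝ → ℝ be differentiable. On ℝ³ with coordinates (x,y,z), set p(x,y,z) = 1 + k(x)·l(y)·m(z) and define the 1-form α by α_{(x,y,z)}(u₁,u₂,u₃) = sin(x)·u₂ + p(x,y,z)·cos(x)·u₃. Set N(x,y,z) = p(x,y,z) − k'(x)·l(y)·m(z)·cos(x)·sin(x). Then at every point q = (x,y,z) with N(q) ≠ 0, the vector R(q) = N(q)⁻¹·( k(x)·l'(y)·m(z)·cos(x), p(q)·sin(x) − k'(x)·l(y)·m(z)·cos(x), cos(x) ) satisfies α_q(R(q)) = 1 and dα_q(R(q), u) = 0 for every u ∈ ℝ³; that is, R is the Reeb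 vector field of the contact form α_b of the paper. -/
open Real

noncomputable section

/-- Points of `ℝ³` with coordinates `(x, y, z)`. -/
abbrev E3 := Fin 3 → ℝ

/-- Exterior derivative of a 1-form `α` on `ℝ³` at `q`, evaluated on `(v, w)`:
`dα_q(v,w) = (fderiv α q v) w − (fderiv α q w) v`. -/
def dform (α : E3 → (E3 →L[ℝ] ℝ)) (q v w : E3) : ℝ :=
  (fderiv ℝ α q v) w - (fderiv ℝ α q w) v

/-- The Reeb vector field of the contact form
`α = sin(x) dy + (1 + k(x)l(y)m(z)) cos(x) dz` of the paper. -/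
theorem reeb_of_alpha_b (k l m : ℝ → ℝ)
    (hk : Differentiable ℝ k) (hl : Differentiable ℝ l) (hm : Differentiable ℝ m)
    (p : E3 → ℝ) (hp : ∀ q : E3, p q = 1 + k (q 0) * l (q 1) * m (q 2))
    (α : E3 → (E3 →L[ℝ] ℝ))
    (hα : ∀ q : E3, α q =
      Real.sin (q 0) • (ContinuousLinearMap.proj 1 : E3 →L[ℝ] ℝ) +
      (p q * Real.cos (q 0)) • (ContinuousLinearMap.proj 2 : E3 →L[ℝ] ℝ))
    (N : E3 → ℝ)
    (hN : ∀ q : E3,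
      N q = p q - deriv k (q 0) * l (q 1) * m (q 2) * Real.cos (q 0) * Real.sin (q 0))
    (q : E3) (hNq : N q ≠ 0)
    (R : E3)
    (hR : R = (N q)⁻¹ •
      ![k (q 0) * deriv l (q 1) * m (q 2) * Real.cos (q 0),
        p q * Real.sin (q 0) - deriv k (q 0) * l (q 1) * m (q 2) * Real.cos (q 0),
        Real.cos (q 0)]) :
    α q R = 1 ∧ ∀ u : E3, dform α q R u = 0 := by
  have h0 : HasFDerivAt (fun r : E3 => r 0) (ContinuousLinearMap.proj 0 : E3 →L[ℝ] ℝ) q :=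
    hasFDerivAt_apply 0 q
  have h1 : HasFDerivAt (fun r : E3 => r 1) (ContinuousLinearMap.proj 1 : E3 →L[ℝ] ℝ) q :=
    hasFDerivAt_apply 1 q
  have h2 : HasFDerivAt (fun r : E3 => r 2) (ContinuousLinearMap.proj 2 : E3 →L[ℝ] ℝ) q :=
    hasFDerivAt_apply 2 q
  have hpd := ((((hk (q 0)).hasDerivAt.comp_hasFDerivAt q h0).mul
    ((hl (q 1)).hasDerivAt.comp_hasFDerivAt q h1)).mul
    ((hm (q 2)).hasDerivAt.comp_hasFDerivAt q h2)).const_add 1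
  have hαd := (h0.sin.smul_const (ContinuousLinearMap.proj 1 : E3 →L[ℝ] ℝ)).add
    ((hpd.mul h0.cos).smul_const (ContinuousLinearMap.proj 2 : E3 →L[ℝ] ℝ))
  have hd := (hαd.congr_of_eventuallyEq (f₁ := α)
    (.of_forall fun r => by rw [hα, hp]; rfl)).fderiv
  have hsc := Real.sin_sq_add_cos_sq (q 0)
  constructor
  · have hRN : α q R = (N q)⁻¹ * N q := by
      rw [hα, hR, hN]
      simp
      linear_combination (p q * (p q - deriv k (q 0) * l (q 1) * m (q 2) * Real.cos (q 0) *
        Real.sin (q 0))⁻¹) * hsc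
    rw [hRN, inv_mul_cancel₀ hNq]
  · intro u
    rw [dform, hd, hR]
    simp [hp]
    ring
end
end

section
/- Let f, g : ℝ² → ℝ be differentiable. On ℝ³ with coordinates (t,u,v), define the 1-form α by α_{(t,u,v)}(w₁,w₂,w₃) = f(t,v)·w₁ + g(t,v)·w₂. At every point q = (t,u,v) where Δ(t,v) := (∂f/∂v)(t,v)·g(t,v) − (∂g/∂v)(t,v)·f(t,v) ≠ 0, the vector R(q) = Δ(t,v)⁻¹·( −(∂g/∂v)(t,v), (∂f/∂v)(t,v), (∂g/∂t)(t,v) ) satisfies α_q(R(q)) = 1 and dα_q(R(q), w) = 0 for every w ∈ ℝ³. -/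
open Real

noncomputable section

/-- A linear functional on `ℝ²` in terms of its values on the standard basis. -/
theorem clm_prod_apply_eq (L : ℝ × ℝ →L[ℝ] ℝ) (a b : ℝ) :
    L (a, b) = a * L (1, 0) + b * L (0, 1) := by
  have h : ((a, b) : ℝ × ℝ) = a • (1, 0) + b • (0, 1) := by simp
  rw [h, map_add, map_smul, map_smul, smul_eq_mul, smul_eq_mul]

/-- The derivative of `q ↦ f (t, v)` on `ℝ³` with coordinates `q = (t, u, v)`. -/
theorem hasFDerivAt_comp_fst_third {f : ℝ × ℝ → ℝ} {q : E3}
    (hf : DifferentiableAt ℝ f (q 0, q 2)) :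
    HasFDerivAt (fun p : E3 => f (p 0, p 2))
      ((fderiv ℝ f (q 0, q 2)).comp
        ((ContinuousLinearMap.proj 0 : E3 →L[ℝ] ℝ).prod (ContinuousLinearMap.proj 2))) q :=
  HasFDerivAt.comp (f := fun p : E3 => (p 0, p 2)) q hf.hasFDerivAt
    ((ContinuousLinearMap.proj 0 : E3 →L[ℝ] ℝ).prod
      (ContinuousLinearMap.proj 2)).hasFDerivAt

/-- The derivative of the 1-form `f dt + g du`, with `f` and `g` functions of `(t, v)`. -/
theorem fderiv_convexification_form_apply {f g : ℝ × ℝ → ℝ} {q : E3}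
    (hf : DifferentiableAt ℝ f (q 0, q 2)) (hg : DifferentiableAt ℝ g (q 0, q 2)) (v w : E3) :
    fderiv ℝ (fun p : E3 => f (p 0, p 2) • (ContinuousLinearMap.proj 0 : E3 →L[ℝ] ℝ) +
      g (p 0, p 2) • (ContinuousLinearMap.proj 1 : E3 →L[ℝ] ℝ)) q v w =
    fderiv ℝ f (q 0, q 2) (v 0, v 2) * w 0 + fderiv ℝ g (q 0, q 2) (v 0, v 2) * w 1 := by
  have h := ((hasFDerivAt_comp_fst_third hf).smul_const
    (ContinuousLinearMap.proj 0 : E3 →L[ℝ] ℝ)).fun_add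
    ((hasFDerivAt_comp_fst_third hg).smul_const (ContinuousLinearMap.proj 1 : E3 →L[ℝ] ℝ))
  rw [h.fderiv]
  simp

/-- The Reeb vector field of the convexification contact form `α = f dt + g du`
of the paper's construction of hyperbolic bypasses. -/
theorem reeb_of_convexification_form (f g : ℝ × ℝ → ℝ)
    (hf : Differentiable ℝ f) (hg : Differentiable ℝ g)
    (α : E3 → (E3 →L[ℝ] ℝ))
    (hα : ∀ q : E3, α q =
      f (q 0, q 2) • (ContinuousLinearMap.proj 0 : E3 →L[ℝ] ℝ) +
      g (q 0, q 2) • (ContinuousLinearMap.proj 1 : E3 →L[ℝ] ℝ))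
    (q : E3)
    (Δ : ℝ)
    (hΔdef : Δ = fderiv ℝ f (q 0, q 2) (0, 1) * g (q 0, q 2) -
      fderiv ℝ g (q 0, q 2) (0, 1) * f (q 0, q 2))
    (hΔ : Δ ≠ 0)
    (R : E3)
    (hR : R = Δ⁻¹ •
      ![-(fderiv ℝ g (q 0, q 2) (0, 1)),
        fderiv ℝ f (q 0, q 2) (0, 1),
        fderiv ℝ g (q 0, q 2) (1, 0)]) :
    α q R = 1 ∧ ∀ w : E3, dform α q R w = 0 := by
  obtain rfl : α = _ := funext hα
  subst hR
  refine ⟨?_, fun w => ?_⟩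
  · simp
    field_simp
    rw [hΔdef]
    ring
  · rw [dform, fderiv_convexification_form_apply (hf _) (hg _),
      fderiv_convexification_form_apply (hf _) (hg _)]
    rw [clm_prod_apply_eq (fderiv ℝ f _) ((_ • _ : E3) 0), clm_prod_apply_eq (fderiv ℝ g _) ((_ • _ : E3) 0),
      clm_prod_apply_eq (fderiv ℝ f _) (w 0), clm_prod_apply_eq (fderiv ℝ g _) (w 0)]
    simp only [Pi.smul_apply, smul_eq_mul, Matrix.cons_val]
    ring
end
end

section
/- Let f, g, h : ℝ² → ℝ and p : ℝ → ℝ be differentiable. On ℝ³ with coordinates (t,u,v), define the 1-form α by α_{(t,u,v)}(w₁,w₂,w₃) = f(t,v)·w₁ + g(t,v)·w₂ + p(u)·h(t,v)·w₃. Then at every point (t,u,v), the volume coefficient α(e₁)·dα(e₂,e₃) − α(e₂)·dα(e₁,e₃) + α(e₃)·dα(e₁,e₂) equals (∂f/∂v)·g − (∂g/∂v)·f + p·h·(∂g/∂t) + p'·h·f − p·(∂h/∂t)·g, where f, g, h and their partial derivatives are evaluated at (t,v), and p, p' at u. In particular α is a contact form exactly where this expression is nonzero. -/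
open Real

noncomputable section

/-- The standard basis vectors of `ℝ³`. -/
def e1 : E3 := ![1, 0, 0]
def e2 : E3 := ![0, 1, 0]
def e3 : E3 := ![0, 0, 1]

/-- The contact condition for the perturbed convexification form
`α = f dt + g du + p(u)·h dv` of the paper: the coefficient of `α ∧ dα` with respect to the
standard volume form is `(∂f/∂v)·g − (∂g/∂v)·f + p·h·(∂g/∂t) + p'·h·f − p·(∂h/∂t)·g`. -/
theorem contact_condition_perturbed_convexification
    (f g h : ℝ × ℝ → ℝ) (p : ℝ → ℝ)
    (hf : Differentiable ℝ f) (hg : Differentiable ℝ g) (hh : Differentiable ℝ h)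
    (hp : Differentiable ℝ p)
    (α : E3 → (E3 →L[ℝ] ℝ))
    (hα : ∀ q : E3, α q =
      f (q 0, q 2) • (ContinuousLinearMap.proj 0 : E3 →L[ℝ] ℝ) +
      g (q 0, q 2) • (ContinuousLinearMap.proj 1 : E3 →L[ℝ] ℝ) +
      (p (q 1) * h (q 0, q 2)) • (ContinuousLinearMap.proj 2 : E3 →L[ℝ] ℝ))
    (q : E3) :
    α q e1 * dform α q e2 e3 - α q e2 * dform α q e1 e3 + α q e3 * dform α q e1 e2 =
      fderiv ℝ f (q 0, q 2) (0, 1) * g (q 0, q 2)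
      - fderiv ℝ g (q 0, q 2) (0, 1) * f (q 0, q 2)
      + p (q 1) * h (q 0, q 2) * fderiv ℝ g (q 0, q 2) (1, 0)
      + deriv p (q 1) * h (q 0, q 2) * f (q 0, q 2)
      - p (q 1) * fderiv ℝ h (q 0, q 2) (1, 0) * g (q 0, q 2) := by
  have hπ (φ : ℝ × ℝ → ℝ) (hφ : Differentiable ℝ φ) :
      HasFDerivAt (fun x : E3 => φ (x 0, x 2))
        ((fderiv ℝ φ (q 0, q 2)).comp
          ((ContinuousLinearMap.proj 0 : E3 →L[ℝ] ℝ).prod (ContinuousLinearMap.proj 2))) q :=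
    HasFDerivAt.comp (g := φ) q (hφ (q 0, q 2)).hasFDerivAt
      ((ContinuousLinearMap.proj 0 : E3 →L[ℝ] ℝ).prod (ContinuousLinearMap.proj 2)).hasFDerivAt
  have hpu : HasFDerivAt (fun x : E3 => p (x 1))
      (deriv p (q 1) • (ContinuousLinearMap.proj 1 : E3 →L[ℝ] ℝ)) q :=
    HasDerivAt.comp_hasFDerivAt (h₂ := p) q (hp (q 1)).hasDerivAt
      (ContinuousLinearMap.proj 1 : E3 →L[ℝ] ℝ).hasFDerivAt
  have hαq := (((hπ f hf).smul_const (ContinuousLinearMap.proj 0 : E3 →L[ℝ] ℝ)).add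
    ((hπ g hg).smul_const (ContinuousLinearMap.proj 1 : E3 →L[ℝ] ℝ))).add
    ((hpu.mul (hπ h hh)).smul_const (ContinuousLinearMap.proj 2 : E3 →L[ℝ] ℝ))
  have hfd := (hαq.congr_of_eventuallyEq (Filter.Eventually.of_forall hα)).fderiv
  have h0 (L : ℝ × ℝ →L[ℝ] ℝ) : L (0, 0) = 0 := map_zero L
  simp only [dform, hfd, hα q]
  simp [e1, e2, e3, h0]
  ring
end
end

section
/- Let k : ℝ → ℝ be differentiable. On ℝ³ with coordinates (x,y,z), define the 1-form α by α_{(x,y,z)}(u₁,u₂,u₃) = k(z)·sin(x)·u₂ + cos(x)·u₃. Then: (a) at every point (x,y,z), the volume coefficient α(e₁)·dα(e₂,e₃) − α(e₂)·dα(e₁,e₃) + α(e₃)·dα(e₁,e₂) equals k(z), so α is a contact form exactly where k(z) ≠ 0; (b) at every point q = (x,y,z) with k(z) ≠ 0, the vector R(q) = k(z)⁻¹·( −k'(z)·sin(x), sin(x), k(z)·cos(x) ) satisfies α_q(R(q)) = 1 and dα_q(R(q), u) = 0 for all u ∈ ℝ³. -/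
open Real

noncomputable section

/-- The exterior derivative of `k(z)·sin(x) dy + cos(x) dz` in coordinates:
`k'(z) sin(x) dz ∧ dy + k(z) cos(x) dx ∧ dy - sin(x) dx ∧ dz`. -/
theorem dform_sin_cos_model {k : ℝ → ℝ} {α : E3 → (E3 →L[ℝ] ℝ)}
    (hα : ∀ q : E3, α q =
      (k (q 2) * Real.sin (q 0)) • (ContinuousLinearMap.proj 1 : E3 →L[ℝ] ℝ) +
      Real.cos (q 0) • (ContinuousLinearMap.proj 2 : E3 →L[ℝ] ℝ))
    {q : E3} (hk : DifferentiableAt ℝ k (q 2)) (v w : E3) :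
    dform α q v w =
      deriv k (q 2) * Real.sin (q 0) * (v 2 * w 1 - w 2 * v 1) +
      k (q 2) * Real.cos (q 0) * (v 0 * w 1 - w 0 * v 1) -
      Real.sin (q 0) * (v 0 * w 2 - w 0 * v 2) := by
  have hx : HasFDerivAt (fun p : E3 => p 0) (ContinuousLinearMap.proj 0 : E3 →L[ℝ] ℝ) q :=
    (ContinuousLinearMap.proj 0 : E3 →L[ℝ] ℝ).hasFDerivAt
  have hz : HasFDerivAt (fun p : E3 => p 2) (ContinuousLinearMap.proj 2 : E3 →L[ℝ] ℝ) q :=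
    (ContinuousLinearMap.proj 2 : E3 →L[ℝ] ℝ).hasFDerivAt
  have hkz : HasFDerivAt (fun p : E3 => k (p 2))
      (deriv k (q 2) • (ContinuousLinearMap.proj 2 : E3 →L[ℝ] ℝ)) q :=
    hk.hasDerivAt.comp_hasFDerivAt q hz
  have hd := ((hkz.mul hx.sin).smul_const (ContinuousLinearMap.proj 1 : E3 →L[ℝ] ℝ)).add
    (hx.cos.smul_const (ContinuousLinearMap.proj 2 : E3 →L[ℝ] ℝ))
  have hα' : HasFDerivAt α _ q := hd.congr_of_eventuallyEq (.of_forall hα)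
  rw [dform, hα'.fderiv]
  simp
  ring

/-- The paper's convexification model `α_conv = k(z)·sin(x) dy + cos(x) dz`:
(a) the coefficient of `α ∧ dα` with respect to the standard volume form is `k(z)`;
(b) where `k(z) ≠ 0`, the Reeb vector field is
`k(z)⁻¹·(−k'(z) sin(x), sin(x), k(z) cos(x))`. -/
theorem convexification_model_contact_and_reeb (k : ℝ → ℝ) (hk : Differentiable ℝ k)
    (α : E3 → (E3 →L[ℝ] ℝ))
    (hα : ∀ q : E3, α q =
      (k (q 2) * Real.sin (q 0)) • (ContinuousLinearMap.proj 1 : E3 →L[ℝ] ℝ) +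
      Real.cos (q 0) • (ContinuousLinearMap.proj 2 : E3 →L[ℝ] ℝ)) :
    (∀ q : E3,
      α q e1 * dform α q e2 e3 - α q e2 * dform α q e1 e3 + α q e3 * dform α q e1 e2 =
        k (q 2)) ∧
    (∀ q : E3, k (q 2) ≠ 0 →
      α q ((k (q 2))⁻¹ •
        ![-(deriv k (q 2)) * Real.sin (q 0), Real.sin (q 0), k (q 2) * Real.cos (q 0)]) = 1 ∧
      ∀ u : E3, dform α q
        ((k (q 2))⁻¹ •
          ![-(deriv k (q 2)) * Real.sin (q 0), Real.sin (q 0), k (q 2) * Real.cos (q 0)])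
        u = 0) := by
  refine ⟨fun q => ?_, fun q hq => ⟨?_, fun u => ?_⟩⟩
  · simp only [dform_sin_cos_model hα (hk _), hα]
    simp [e1, e2, e3]
    linear_combination k (q 2) * Real.sin_sq_add_cos_sq (q 0)
  · simp [hα]
    field_simp
    linear_combination Real.sin_sq_add_cos_sq (q 0)
  · rw [dform_sin_cos_model hα (hk _)]
    simp
    field_simp
    ring
end
end
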